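/- Under all hypotheses of the local convergence theorem for the Gauss–Newton–Kurchatov method, assume additionally the zero-residual condition η = 0 (i.e. F(x*) + G(x*) = 0). Then C₁ = C₂ = 0, so the error estimate reduces to ‖x_{n+1} − x*‖ ≤ C₃‖x_n − x*‖² + C₄‖x_n − x_{n−1}‖²‖x_n − x*‖ for all n ≥ 0. If moreover there exist a constant C₅ > 0 and an index N such that for all n ≥ N one has ‖x_n − x*‖ ≥ C₅‖x_{n−1} − x*‖² and ‖x_n − x*‖ ≤ ‖x_{n−1} − x*‖, then for all n ≥ N, ‖x_{n+1} − x*‖ ≤ C₆‖x_n − x*‖² where C₆ = C₃ + 4C₄/C₅; hence the convergence order of the method is quadratic. -/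

import Mathlib

open Metric

/-- The function `g(r) = B[1 − B(2α + (L₀+2M₀)r + 4N₀r²)((L₀+2M₀)r + 4N₀r²)]⁻¹`. -/
noncomputable def gnkG (B α L₀ M₀ N₀ r : ℝ) : ℝ :=
  B * (1 - B * (2*α + (L₀ + 2*M₀)*r + 4*N₀*r^2) * ((L₀ + 2*M₀)*r + 4*N₀*r^2))⁻¹

/-- The function `h(t) = B[2α + (L₀+2M₀)t + N₀t²]·[(L₀/2+M₀)t + N₀t²]`. -/
noncomputable def gnkH (B α L₀ M₀ N₀ t : ℝ) : ℝ :=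
  B * (2*α + (L₀ + 2*M₀)*t + N₀*t^2) * ((L₀/2 + M₀)*t + N₀*t^2)

/-- The radius function `q`. -/
noncomputable def gnkQ (B α η L M N L₀ M₀ N₀ r : ℝ) : ℝ :=
  B * ((α + (L + 2*M)*r + 4*N*r^2) * ((L/2 + M)*r + 4*N*r^2)
      + (L + 2*M + 4*N*r)*η)
    + B * (2*α + (L₀ + 2*M₀)*r + 4*N₀*r^2) * ((L₀ + 2*M₀)*r + 4*N₀*r^2) - 1

theorem gnk_scalar {σ α B v w u : ℝ} (hσ : 0 < σ) (hB : B * σ^2 = 1) (hα : σ ≤ α)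
    (hw : v ≤ w) (hv : 0 < v) (hu : 0 ≤ u)
    (h : B * ((α + w) * v) + B * (2*α + u) * u = 1) :
    v + 7/3*u ≤ σ := by
  have h1 : (σ + v) * v + (2*σ + u) * u ≤ σ^2 := by
    have e1 : (α + w) * v + (2*α + u) * u = σ^2 := by
      have hs : σ^2 ≠ 0 := by positivity
      have hBs : B = (σ^2)⁻¹ := eq_inv_of_mul_eq_one_left hB
      rw [hBs] at h
      field_simp at h
      linarith
    have e2 : (σ + v) * v ≤ (α + w) * v := by gcongr
    have e3 : (2*σ + u) * u ≤ (2*α + u) * u := by gcongr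
    linarith
  have hu2 : u ≤ 3/7*σ := by
    by_contra hc
    push Not at hc
    nlinarith [mul_pos hv hσ, mul_pos hv hv, mul_pos hσ hσ]
  by_contra hc
  push Not at hc
  have h3 : 0 ≤ σ - 7/3*u := by linarith
  have : (2*σ - 7/3*u) * (σ - 7/3*u) ≤ (σ + v) * v := by
    apply mul_le_mul <;> linarith
  nlinarith [sq_nonneg (σ - 5/2*u), mul_pos hσ hσ, sq_nonneg u]

theorem gnk_case {σ v u K N N₀ r e d : ℝ} (hN : 0 < N) (hK : 0 < K)
    (hN₀ : 0 < N₀) (he : 0 ≤ e) (hr : 0 < r)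
    (hv : v = K*r + 4*N*r^2) (hu : 4*N₀*r^2 ≤ u) (hs : v + 7/3*u ≤ σ)
    (hd : d^2 ≤ 16/3*r*e) :
    v * (K*e + N₀*d^2) ≤ (σ-u)*(K*e+N*d^2) := by
  have hu0 : 0 ≤ u := le_trans (by positivity) hu
  have hv0 : 0 < v := by rw [hv]; positivity
  have h1 : v*(N₀*d^2) ≤ K*e*(4/3*u) + u*(N*d^2) := by
    have a1 : K*r*N₀*d^2 ≤ K*r*N₀*(16/3*r*e) := by gcongr
    have a2 : K*e*(4/3)*(4*N₀*r^2) ≤ K*e*(4/3)*u := by gcongr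
    have a3 : (4*N₀*r^2)*(N*d^2) ≤ u*(N*d^2) := by gcongr
    rw [hv]; nlinarith
  have h2 : (v+4/3*u)*(K*e) ≤ (σ-u)*(K*e) := by gcongr; linarith
  have h3 : u*(N*d^2) ≤ (σ-u)*(N*d^2) := by gcongr; linarith
  nlinarith

theorem gnk_lower {E H : Type*} [NormedAddCommGroup E] [InnerProductSpace ℝ E]
    [NormedAddCommGroup H] [InnerProductSpace ℝ H] [CompleteSpace E] [CompleteSpace H]
    (A : E →L[ℝ] H) {B σ : ℝ} (hσ : 0 < σ) (hBσ : B * σ^2 = 1)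
    (hU : IsUnit ((ContinuousLinearMap.adjoint A).comp A))
    (hB : ‖Ring.inverse ((ContinuousLinearMap.adjoint A).comp A)‖ ≤ B) (z : E) :
    σ * ‖z‖ ≤ ‖A z‖ := by
  set S := (ContinuousLinearMap.adjoint A).comp A with hS
  set T := Ring.inverse S with hT
  have hST : S (T z) = z := by
    have := Ring.mul_inverse_cancel S hU
    exact congrArg (fun f : E →L[ℝ] E => f z) this
  have hS' : ∀ y y', inner ℝ y (S y') = inner ℝ (A y) (A y') := by
    intro y y'
    simp [hS, ContinuousLinearMap.adjoint_inner_right]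
  have h1 : ‖z‖^2 ≤ ‖A z‖ * ‖A (T z)‖ := by
    have := hS' z (T z)
    rw [hST, real_inner_self_eq_norm_sq] at this
    rw [this]; exact real_inner_le_norm _ _
  have h2 : ‖A (T z)‖^2 ≤ B * ‖z‖^2 := by
    have := hS' (T z) (T z)
    rw [hST, real_inner_self_eq_norm_sq] at this
    rw [← this]
    calc _ ≤ ‖T z‖ * ‖z‖ := real_inner_le_norm _ _
      _ ≤ (B * ‖z‖) * ‖z‖ := by
        gcongr
        exact (T.le_opNorm z).trans (by gcongr)
      _ = _ := by ring
  have h3 : σ * ‖A (T z)‖ ≤ ‖z‖ := by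
    apply (sq_le_sq₀ (by positivity) (norm_nonneg _)).1
    calc (σ * ‖A (T z)‖)^2 = σ^2 * ‖A (T z)‖^2 := by ring
      _ ≤ σ^2 * (B * ‖z‖^2) := by gcongr
      _ = (B*σ^2) * ‖z‖^2 := by ring
      _ = _ := by rw [hBσ, one_mul]
  rcases (norm_nonneg z).eq_or_lt with h0 | h0
  · rw [← h0]; simp
  · have : σ * ‖z‖ * ‖z‖ ≤ ‖A z‖ * ‖z‖ := by
      calc σ * ‖z‖ * ‖z‖ = σ * ‖z‖^2 := by ring
        _ ≤ σ * (‖A z‖ * ‖A (T z)‖) := by gcongr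
        _ = ‖A z‖ * (σ * ‖A (T z)‖) := by ring
        _ ≤ _ := by gcongr
    exact le_of_mul_le_mul_right this h0

theorem gnk_pinv {E H : Type*} [NormedAddCommGroup E] [InnerProductSpace ℝ E]
    [NormedAddCommGroup H] [InnerProductSpace ℝ H] [FiniteDimensional ℝ E] [CompleteSpace E]
    [CompleteSpace H]
    (A : E →L[ℝ] H) {c : ℝ} (hc : 0 < c) (hA : ∀ z, c * ‖z‖ ≤ ‖A z‖) (x : E) (f : H) :
    c * ‖x - (Ring.inverse ((ContinuousLinearMap.adjoint A).comp A))
      ((ContinuousLinearMap.adjoint A) f)‖ ≤ ‖A x - f‖ := by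
  set S := (ContinuousLinearMap.adjoint A).comp A with hS
  have hS' : ∀ y y', inner ℝ y (S y') = inner ℝ (A y) (A y') := by
    intro y y'
    simp [hS, ContinuousLinearMap.adjoint_inner_right]
  have hinj : Function.Injective S := by
    rw [injective_iff_map_eq_zero]
    intro z hz
    have h := hS' z z
    rw [hz, inner_zero_right, real_inner_self_eq_norm_sq] at h
    have h' : ‖A z‖ = 0 := by
      exact pow_eq_zero_iff (two_ne_zero) |>.1 h.symm
    have := hA z
    rw [h'] at this
    have h4 : ‖z‖ ≤ 0 := by
      by_contra hh
      push Not at hh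
      nlinarith [mul_pos hc hh]
    exact norm_le_zero_iff.1 h4
  have hU : IsUnit S := by
    rw [ContinuousLinearMap.isUnit_iff_bijective]
    exact ⟨hinj, (LinearMap.injective_iff_surjective (f := (S : E →ₗ[ℝ] E))).1 hinj⟩
  set z := x - (Ring.inverse S) ((ContinuousLinearMap.adjoint A) f) with hz
  have hSz : S z = (ContinuousLinearMap.adjoint A) (A x - f) := by
    have h5 : S (Ring.inverse S ((ContinuousLinearMap.adjoint A) f))
        = (ContinuousLinearMap.adjoint A) f :=
      congrArg (fun g : E →L[ℝ] E => g ((ContinuousLinearMap.adjoint A) f))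
        (Ring.mul_inverse_cancel S hU)
    rw [hz, map_sub, h5, map_sub]
    simp [hS]
  refine (hA z).trans ?_
  have h := hS' z z
  rw [hSz, ContinuousLinearMap.adjoint_inner_right, real_inner_self_eq_norm_sq] at h
  have h6 := real_inner_le_norm (A z) (A x - f)
  rcases (norm_nonneg (A z)).eq_or_lt with h0 | h0
  · rw [← h0]; exact norm_nonneg _
  · nlinarith

theorem gnk_taylor {E H : Type*} [NormedAddCommGroup E] [NormedSpace ℝ E]
    [NormedAddCommGroup H] [NormedSpace ℝ H] (F : E → H) (F' : E → (E →L[ℝ] H)) (s : Set E)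
    (hs : Convex ℝ s) (hF : ∀ x ∈ s, HasFDerivAt F (F' x) x) {L : ℝ}
    (hL : ∀ x ∈ s, ∀ y ∈ s, ‖F' x - F' y‖ ≤ L * ‖x - y‖) {x y : E} (hx : x ∈ s) (hy : y ∈ s) :
    ‖F' x (x - y) - (F x - F y)‖ ≤ L/2 * ‖x - y‖^2 := by
  have hmem : ∀ t ∈ Set.Icc (0:ℝ) 1, x + t • (y - x) ∈ s := by
    intro t ht
    exact hs.add_smul_sub_mem hx hy ht
  have hd : ∀ t ∈ Set.Icc (0:ℝ) 1, HasDerivAt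
      (fun t : ℝ => F (x + t • (y - x)) - F x - t • F' x (y - x))
      ((F' (x + t • (y - x)) - F' x) (y - x)) t := by
    intro t ht
    have h1 : HasDerivAt (fun t : ℝ => x + t • (y - x)) (y - x) t := by
      simpa using ((hasDerivAt_id t).smul_const (y - x)).const_add x
    have h2 := (hF _ (hmem t ht)).comp_hasDerivAt t h1
    have h3 : HasDerivAt (fun t : ℝ => t • F' x (y - x)) (F' x (y - x)) t := by
      simpa using ((hasDerivAt_id t).smul_const (F' x (y - x)))
    exact (h2.sub_const (F x)).sub h3
  have key := image_norm_le_of_norm_deriv_right_le_deriv_boundary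
    (f := fun t : ℝ => F (x + t • (y - x)) - F x - t • F' x (y - x))
    (f' := fun t => (F' (x + t • (y - x)) - F' x) (y - x))
    (a := 0) (b := 1) (B := fun t => L/2 * ‖x - y‖^2 * t^2)
    (B' := fun t => L * ‖x-y‖^2 * t)
    (fun t ht => (hd t ht).continuousAt.continuousWithinAt)
    (fun t ht => (hd t ⟨ht.1, ht.2.le⟩).hasDerivWithinAt)
    (by simp)
    (fun t => by
      have := (hasDerivAt_pow 2 t).const_mul (L/2 * ‖x - y‖^2)
      have e2 : L * ‖x-y‖^2 * t = L/2 * ‖x - y‖^2 * ((2:ℕ) * t^(2-1)) := by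
        norm_num; ring
      rw [e2]; exact this)
    (fun t ht => by
      have ht' : t ∈ Set.Icc (0:ℝ) 1 := ⟨ht.1, ht.2.le⟩
      have h1 := hL _ (hmem t ht') x hx
      have h2 : ‖x + t • (y - x) - x‖ = t * ‖x - y‖ := by
        rw [add_sub_cancel_left, norm_smul, Real.norm_of_nonneg ht.1, norm_sub_rev]
      rw [h2] at h1
      calc _ ≤ ‖F' (x + t • (y - x)) - F' x‖ * ‖y - x‖ := ContinuousLinearMap.le_opNorm _ _
        _ ≤ (L * (t * ‖x - y‖)) * ‖y - x‖ := by gcongr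
        _ = _ := by rw [norm_sub_rev y x]; ring)
    (x := 1) (by simp)
  have e : F' x (x - y) - (F x - F y)
      = F (x + (1:ℝ) • (y - x)) - F x - (1:ℝ) • F' x (y - x) := by
    rw [← neg_sub y x, map_neg]; simp; abel
  rw [e]
  simpa using key


theorem gnk_gamma {B σ α L₀ M₀ N₀ r u γ : ℝ} (hB : 0 < B) (hσ : 0 < σ) (hα : σ ≤ α)
    (hL₀ : 0 < L₀) (hM₀ : 0 < M₀) (hN₀ : 0 < N₀) (hr : 0 < r) (hγ : 0 < γ)
    (hu : u = (L₀ + 2*M₀)*r + 4*N₀*r^2) (hus : 7/3*u ≤ σ)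
    (hlt : B * (2*α + u) * u < 1) (hroot : gnkH B α L₀ M₀ N₀ γ = 1) : 5/3*r ≤ γ := by
  by_contra hc
  push Not at hc
  have hu0 : 0 < u := by rw [hu]; positivity
  have h1 : γ^2 ≤ (5/3*r)^2 := by gcongr
  have p1 : (L₀ + 2*M₀)*γ ≤ (L₀ + 2*M₀)*(5/3*r) := by gcongr
  have p2 : N₀*γ^2 ≤ N₀*(5/3*r)^2 := by gcongr
  have p3 : 0 < N₀*r^2 := by positivity
  have a1 : 2*α + (L₀ + 2*M₀)*γ + N₀*γ^2 ≤ 2*α+5/3*u := by rw [hu]; nlinarith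
  have a2 : (L₀/2 + M₀)*γ + N₀*γ^2 ≤ 5/6*u := by rw [hu]; nlinarith
  have hα0 : 0 < α := by linarith
  have : gnkH B α L₀ M₀ N₀ γ ≤ B * (2*α+5/3*u) * (5/6*u) := by
    unfold gnkH
    gcongr
  have h3 : B * (2*α+5/3*u) * (5/6*u) ≤ B * (2*α + u) * u := by
    have : 0 ≤ B * u * (2*α + u - (2*α+5/3*u)*(5/6)) :=
      mul_nonneg (by positivity) (by linarith)
    nlinarith
  linarith

set_option maxHeartbeats 2000000 in
/-- zero-residual case of the local convergence theorem for the
Gauss–Newton–Kurchatov method: if `η = 0` (i.e. `F(x*) + G(x*) = 0`) then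
`C₁ = C₂ = 0`, the error estimate reduces to
`‖x_{n+1} − x*‖ ≤ C₃‖x_n − x*‖² + C₄‖x_n − x_{n−1}‖²‖x_n − x*‖`, and if moreover
`‖x_n − x*‖ ≥ C₅‖x_{n−1} − x*‖²` and `‖x_n − x*‖ ≤ ‖x_{n−1} − x*‖` for all
`n ≥ N`, then `‖x_{n+1} − x*‖ ≤ C₆‖x_n − x*‖²` with `C₆ = C₃ + 4C₄/C₅`
(quadratic convergence).  Indexing as in the local convergence theorem:
`x 0` is `x₋₁`, `x (k+1)` is `x_k`. -/
theorem gauss_newton_kurchatov_quadratic_convergence_zero_residual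
    {n m : ℕ} (hnm : n ≤ m)
    (F G : EuclideanSpace ℝ (Fin n) → EuclideanSpace ℝ (Fin m))
    (F' : EuclideanSpace ℝ (Fin n) →
      (EuclideanSpace ℝ (Fin n) →L[ℝ] EuclideanSpace ℝ (Fin m)))
    (δG : EuclideanSpace ℝ (Fin n) → EuclideanSpace ℝ (Fin n) →
      (EuclideanSpace ℝ (Fin n) →L[ℝ] EuclideanSpace ℝ (Fin m)))
    (δ₂G : EuclideanSpace ℝ (Fin n) → EuclideanSpace ℝ (Fin n) →
      EuclideanSpace ℝ (Fin n) →
      (EuclideanSpace ℝ (Fin n) →L[ℝ]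
        (EuclideanSpace ℝ (Fin n) →L[ℝ] EuclideanSpace ℝ (Fin m))))
    (D : Set (EuclideanSpace ℝ (Fin n)))
    (hD_open : IsOpen D) (hD_conv : Convex ℝ D)
    (hF_deriv : ∀ x ∈ D, HasFDerivAt F (F' x) x)
    (hF'_cont : ContinuousOn F' D)
    (hG_cont : ContinuousOn G D)
    -- divided-difference laws
    (hδG : ∀ x y, (δG x y) (x - y) = G x - G y)
    (hlaw₁ : ∀ u v y, δG u y - δG v y = (δ₂G u y v) (u - v))
    (hlaw₂ : ∀ x u v, δG x u - δG x v = (δ₂G x u v) (u - v))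
    -- the stationary point and the constants
    (xs : EuclideanSpace ℝ (Fin n)) (hxs : xs ∈ D)
    (B α η L₀ M₀ N₀ L M N γ rstar : ℝ)
    (hL₀_pos : 0 < L₀) (hM₀_pos : 0 < M₀) (hN₀_pos : 0 < N₀)
    (hL_pos : 0 < L) (hM_pos : 0 < M) (hN_pos : 0 < N)
    (hstat : (ContinuousLinearMap.adjoint (F' xs + δG xs xs)) (F xs + G xs) = 0)
    (hAs_unit : IsUnit ((ContinuousLinearMap.adjoint (F' xs + δG xs xs)).comp
      (F' xs + δG xs xs)))
    (hB : ‖Ring.inverse ((ContinuousLinearMap.adjoint (F' xs + δG xs xs)).comp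
      (F' xs + δG xs xs))‖ ≤ B)
    (hη : ‖F xs + G xs‖ ≤ η)
    (hα : ‖F' xs + δG xs xs‖ ≤ α)
    -- center-Lipschitz conditions on D
    (hL₀ : ∀ x ∈ D, ‖F' x - F' xs‖ ≤ L₀ * ‖x - xs‖)
    (hM₀ : ∀ x ∈ D, ∀ y ∈ D, ∀ u ∈ D, ∀ v ∈ D,
      ‖δG x y - δG u v‖ ≤ M₀ * (‖x - u‖ + ‖y - v‖))
    (hN₀ : ∀ u ∈ D, ∀ v ∈ D, ∀ x ∈ D, ∀ y ∈ D,
      ‖δ₂G u x y - δ₂G v x y‖ ≤ N₀ * ‖u - v‖)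
    -- γ is the smallest positive root of h(t) = 1
    (hγ_pos : 0 < γ) (hγ_root : gnkH B α L₀ M₀ N₀ γ = 1)
    (hγ_min : ∀ t, 0 < t → gnkH B α L₀ M₀ N₀ t = 1 → γ ≤ t)
    -- restricted Lipschitz conditions on D₀ = D ∩ ball x* γ
    (hL : ∀ x ∈ D ∩ ball xs γ, ∀ y ∈ D ∩ ball xs γ,
      ‖F' x - F' y‖ ≤ L * ‖x - y‖)
    (hM : ∀ x ∈ D ∩ ball xs γ, ∀ y ∈ D ∩ ball xs γ, ∀ u ∈ D ∩ ball xs γ,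
      ∀ v ∈ D ∩ ball xs γ, ‖δG x y - δG u v‖ ≤ M * (‖x - u‖ + ‖y - v‖))
    (hN : ∀ u ∈ D ∩ ball xs γ, ∀ v ∈ D ∩ ball xs γ, ∀ x ∈ D ∩ ball xs γ,
      ∀ y ∈ D ∩ ball xs γ, ‖δ₂G u x y - δ₂G v x y‖ ≤ N * ‖u - v‖)
    (hsmall : B * (L + 2*M) * η < 1)
    -- r* is the unique positive zero of q
    (hrs_pos : 0 < rstar) (hrs_root : gnkQ B α η L M N L₀ M₀ N₀ rstar = 0)
    (hrs_unique : ∀ r, 0 < r → gnkQ B α η L M N L₀ M₀ N₀ r = 0 → r = rstar)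
    (hball : ball xs (3 * rstar) ⊆ D)
    -- the iteration, started from x₋₁ = x 0 and x₀ = x 1
    (x : ℕ → EuclideanSpace ℝ (Fin n))
    (hinit_m1 : x 0 ∈ ball xs rstar) (hinit₀ : x 1 ∈ ball xs rstar)
    (A : ℕ → (EuclideanSpace ℝ (Fin n) →L[ℝ] EuclideanSpace ℝ (Fin m)))
    (hA : ∀ k, A k = F' (x (k+1)) + δG (2 • x (k+1) - x k) (x k))
    (hiter : ∀ k, x (k+2) = x (k+1) -
      (Ring.inverse ((ContinuousLinearMap.adjoint (A k)).comp (A k)))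
        ((ContinuousLinearMap.adjoint (A k)) (F (x (k+1)) + G (x (k+1)))))
    -- zero-residual hypotheses
    (hη0 : η = 0) (hres : F xs + G xs = 0) :
    gnkG B α L₀ M₀ N₀ rstar * (L + 2*M) * η = 0 ∧
    gnkG B α L₀ M₀ N₀ rstar * N * η = 0 ∧
    (∀ k, ‖x (k+2) - xs‖ ≤
      gnkG B α L₀ M₀ N₀ rstar * (L/2 + M)
          * (α + (L + 2*M)*rstar + 4*N*rstar^2) * ‖x (k+1) - xs‖^2
      + gnkG B α L₀ M₀ N₀ rstar * N
          * (α + (L + 2*M)*rstar + 4*N*rstar^2) * ‖x (k+1) - x k‖^2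
          * ‖x (k+1) - xs‖) ∧
    (∀ C₅ : ℝ, 0 < C₅ → ∀ N' : ℕ,
      (∀ k, N' ≤ k → C₅ * ‖x k - xs‖^2 ≤ ‖x (k+1) - xs‖ ∧
        ‖x (k+1) - xs‖ ≤ ‖x k - xs‖) →
      ∀ k, N' ≤ k → ‖x (k+2) - xs‖ ≤
        (gnkG B α L₀ M₀ N₀ rstar * (L/2 + M)
            * (α + (L + 2*M)*rstar + 4*N*rstar^2)
          + 4 * (gnkG B α L₀ M₀ N₀ rstar * N
            * (α + (L + 2*M)*rstar + 4*N*rstar^2)) / C₅)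
          * ‖x (k+1) - xs‖^2) := by
  have hC1 : gnkG B α L₀ M₀ N₀ rstar * (L + 2*M) * η = 0 := by rw [hη0, mul_zero]
  have hC2 : gnkG B α L₀ M₀ N₀ rstar * N * η = 0 := by rw [hη0, mul_zero]
  have hα0 : 0 ≤ α := (norm_nonneg _).trans hα
  have hB0 : 0 ≤ B := (norm_nonneg _).trans hB
  have hBpos : 0 < B := by
    rcases hB0.eq_or_lt with h | h
    · exfalso
      rw [← h] at hrs_root
      norm_num [gnkQ] at hrs_root
    · exact h
  obtain ⟨K, hK⟩ : ∃ K, K = L/2 + M := ⟨_, rfl⟩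
  obtain ⟨v, hv⟩ : ∃ v, v = K*rstar + 4*N*rstar^2 := ⟨_, rfl⟩
  obtain ⟨w, hw⟩ : ∃ w, w = (L + 2*M)*rstar + 4*N*rstar^2 := ⟨_, rfl⟩
  obtain ⟨u, hu⟩ : ∃ u, u = (L₀ + 2*M₀)*rstar + 4*N₀*rstar^2 := ⟨_, rfl⟩
  have hKpos : 0 < K := by rw [hK]; positivity
  have hvpos : 0 < v := by rw [hv]; positivity
  have hupos : 0 < u := by rw [hu]; positivity
  have hvw : v ≤ w := by
    have : 0 < K * rstar := by positivity
    rw [hv, hw]; rw [hK] at *; nlinarith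
  have hq : B * ((α + w) * v) + B * (2*α + u) * u = 1 := by
    unfold gnkQ at hrs_root
    rw [hη0] at hrs_root
    rw [hw, hv, hu, hK]
    linarith
  have hαw : 0 < α + w := by linarith
  have hg : gnkG B α L₀ M₀ N₀ rstar * (α + w) = v⁻¹ := by
    have e1 : gnkG B α L₀ M₀ N₀ rstar = B * (1 - B * (2*α+u)*u)⁻¹ := by
      unfold gnkG; rw [hu]; ring
    have e2 : 1 - B * (2*α+u)*u = B * ((α + w) * v) := by linarith
    rw [e1, e2]
    field_simp
  have hC3 : gnkG B α L₀ M₀ N₀ rstar * (L/2 + M) * (α + (L + 2*M)*rstar + 4*N*rstar^2)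
      = v⁻¹ * K := by
    rw [← hg, hw, hK]; ring
  have hC4 : gnkG B α L₀ M₀ N₀ rstar * N * (α + (L + 2*M)*rstar + 4*N*rstar^2)
      = v⁻¹ * N := by
    rw [← hg, hw]; ring
  rw [hC3, hC4]
  have hmain : ∀ k, ‖x (k+2) - xs‖ ≤ v⁻¹ * K * ‖x (k+1) - xs‖^2
      + v⁻¹ * N * ‖x (k+1) - x k‖^2 * ‖x (k+1) - xs‖ := by
    rcases subsingleton_or_nontrivial (EuclideanSpace ℝ (Fin n)) with hsub | hnt
    · intro k
      rw [Subsingleton.elim (x (k+2) - xs) 0, norm_zero]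
      positivity
    obtain ⟨σ, hσ, hBσ⟩ : ∃ σ : ℝ, 0 < σ ∧ B * σ^2 = 1 := by
      refine ⟨(√B)⁻¹, by positivity, ?_⟩
      rw [inv_pow, Real.sq_sqrt hB0, mul_inv_cancel₀ hBpos.ne']
    have hlow := gnk_lower (F' xs + δG xs xs) hσ hBσ hAs_unit hB
    have hσα : σ ≤ α := by
      obtain ⟨z, hz⟩ := exists_ne (0 : EuclideanSpace ℝ (Fin n))
      have hz' : 0 < ‖z‖ := norm_pos_iff.2 hz
      have h1 : σ * ‖z‖ ≤ α * ‖z‖ :=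
        (hlow z).trans ((ContinuousLinearMap.le_opNorm _ z).trans (by gcongr))
      exact le_of_mul_le_mul_right h1 hz'
    have hsc := gnk_scalar hσ hBσ hσα hvw hvpos hupos.le hq
    have hγr : 5/3*rstar ≤ γ := by
      refine gnk_gamma hBpos hσ hσα hL₀_pos hM₀_pos hN₀_pos hrs_pos hγ_pos hu (by linarith) ?_
        hγ_root
      have : 0 < B * ((α + w) * v) := by positivity
      linarith
    have hrD : ∀ y, ‖y - xs‖ < rstar → y ∈ D ∩ ball xs γ := by
      intro y hy
      refine ⟨hball ?_, ?_⟩ <;> rw [mem_ball_iff_norm] <;> linarith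
    have hconv : Convex ℝ (D ∩ ball xs γ) := hD_conv.inter (convex_ball _ _)
    have hstep : ∀ k, ‖x k - xs‖ < rstar → ‖x (k+1) - xs‖ < rstar →
        ‖x (k+2) - xs‖ ≤ v⁻¹ * K * ‖x (k+1) - xs‖^2
          + v⁻¹ * N * ‖x (k+1) - x k‖^2 * ‖x (k+1) - xs‖ := by
      intro k hp he
      have hit := hiter k
      have hAk := hA k
      obtain ⟨a, ha⟩ : ∃ a, a = x k := ⟨_, rfl⟩
      obtain ⟨b, hb⟩ : ∃ b, b = x (k+1) := ⟨_, rfl⟩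
      rw [← ha] at hp hAk ⊢
      rw [← hb] at he hAk hit ⊢
      obtain ⟨y, hy⟩ : ∃ y, y = 2 • b - a := ⟨_, rfl⟩
      rw [← hy] at hAk
      have hyb : y - b = b - a := by rw [hy, two_nsmul]; abel
      have haD := hrD a hp
      have hbD := hrD b he
      have hsD : xs ∈ D ∩ ball xs γ := hrD xs (by simpa using hrs_pos)
      have hd : ‖b - a‖ ≤ ‖b - xs‖ + ‖a - xs‖ := by
        rw [← sub_sub_sub_cancel_right b a xs]; exact norm_sub_le _ _
      have hyn : ‖y - xs‖ ≤ ‖b - xs‖ + ‖b - a‖ := by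
        have : y - xs = (b - xs) + (b - a) := by rw [← hyb]; abel
        rw [this]; exact norm_add_le _ _
      have hyD : y ∈ D := hball (by rw [mem_ball_iff_norm]; linarith)
      have hdd : δG y a - δG b b = (δ₂G y a b - δ₂G b a b) (b - a) := by
        have e1 := hlaw₁ y b a
        have e2 := hlaw₂ b a b
        rw [hyb] at e1
        rw [sub_apply, ← e1, ← neg_sub a b, map_neg, ← e2]
        abel
      have hddn : ∀ c : ℝ, ‖δ₂G y a b - δ₂G b a b‖ ≤ c * ‖y - b‖ →
          ‖δG y a - δG b b‖ ≤ c * ‖b - a‖^2 := by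
        intro c hc
        rw [hdd]
        calc _ ≤ ‖δ₂G y a b - δ₂G b a b‖ * ‖b - a‖ := ContinuousLinearMap.le_opNorm _ _
          _ ≤ (c * ‖y - b‖) * ‖b - a‖ := by gcongr
          _ = _ := by rw [hyb]; ring
      have hd0 := hddn N₀ (hN₀ y hyD b hbD.1 a haD.1 b hbD.1)
      -- perturbation of A
      have hpert : ‖A k - (F' xs + δG xs xs)‖ ≤ u := by
        have e : A k - (F' xs + δG xs xs)
            = (F' b - F' xs) + (δG y a - δG b b) + (δG b b - δG xs xs) := by
          rw [hAk]; abel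
        rw [e]
        have h1 := hL₀ b hbD.1
        have h2 := hM₀ b hbD.1 b hbD.1 xs hxs xs hxs
        have h3 := norm_add₃_le (a := F' b - F' xs) (b := δG y a - δG b b)
          (c := δG b b - δG xs xs)
        have h4 : N₀ * ‖b - a‖^2 ≤ N₀ * (2*rstar)^2 := by
          gcongr; linarith
        have h5 : (L₀ + 2*M₀) * ‖b - xs‖ ≤ (L₀ + 2*M₀) * rstar := by gcongr
        have h6 : N₀ * (2*rstar)^2 = 4*N₀*rstar^2 := by ring
        have h7 : L₀ * ‖b - xs‖ + M₀ * (‖b - xs‖ + ‖b - xs‖) = (L₀ + 2*M₀) * ‖b - xs‖ := by ring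
        rw [hu]
        linarith
      have hAlow : ∀ z, (σ - u) * ‖z‖ ≤ ‖A k z‖ := by
        intro z
        have h1 := hlow z
        have h2 : ‖(A k - (F' xs + δG xs xs)) z‖ ≤ u * ‖z‖ :=
          (ContinuousLinearMap.le_opNorm _ z).trans (by gcongr)
        have h3 : (F' xs + δG xs xs) z = A k z - (A k - (F' xs + δG xs xs)) z := by
          rw [sub_apply]; abel
        have h4 := norm_sub_le (A k z) ((A k - (F' xs + δG xs xs)) z)
        rw [← h3] at h4
        linarith
      have hc : 0 < σ - u := by linarith
      have hpin := gnk_pinv (A k) hc hAlow (b - xs) (F b + G b)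
      have hz : x (k+2) - xs = b - xs -
          (Ring.inverse ((ContinuousLinearMap.adjoint (A k)).comp (A k)))
          ((ContinuousLinearMap.adjoint (A k)) (F b + G b)) := by
        rw [hit]; abel
      rw [← hz] at hpin
      have hres' : ∀ c : ℝ, ‖δG y a - δG b b‖ ≤ c * ‖b - a‖^2 →
          ‖A k (b - xs) - (F b + G b)‖ ≤ (K * ‖b - xs‖ + c * ‖b - a‖^2) * ‖b - xs‖ := by
        intro c hcc
        have e : A k (b - xs) - (F b + G b) = (F' b (b - xs) - (F b - F xs))
            + (δG y a - δG b b) (b - xs) + (δG b b - δG b xs) (b - xs) := by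
          have e1 : (δG b b - δG b xs) (b - xs) = δG b b (b - xs) - (G b - G xs) := by
            rw [sub_apply, hδG]
          have e2 : G xs = - F xs := eq_neg_of_add_eq_zero_right hres
          rw [e1, hAk, add_apply, sub_apply, e2]
          abel
        rw [e]
        have t1 := gnk_taylor F F' (D ∩ ball xs γ) hconv (fun z hz => hF_deriv z hz.1) hL hbD hsD
        have t2 : ‖(δG y a - δG b b) (b - xs)‖ ≤ (c * ‖b - a‖^2) * ‖b - xs‖ :=
          (ContinuousLinearMap.le_opNorm _ _).trans (by gcongr)
        have t3 : ‖(δG b b - δG b xs) (b - xs)‖ ≤ (M * ‖b - xs‖) * ‖b - xs‖ := by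
          refine (ContinuousLinearMap.le_opNorm _ _).trans ?_
          gcongr
          have := hM b hbD b hbD b hbD xs hsD
          simpa using this
        refine norm_add₃_le.trans ?_
        have t4 : (K * ‖b - xs‖ + c * ‖b - a‖^2) * ‖b - xs‖ = L/2 * ‖b - xs‖^2
            + (c * ‖b - a‖^2) * ‖b - xs‖ + (M * ‖b - xs‖) * ‖b - xs‖ := by rw [hK]; ring
        rw [t4]
        linarith
      -- final inequality
      have hfin : v * ‖A k (b - xs) - (F b + G b)‖
          ≤ (σ - u) * ((K * ‖b - xs‖ + N * ‖b - a‖^2) * ‖b - xs‖) := by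
        by_cases hyγ : y ∈ ball xs γ
        · have h1 := hres' N (hddn N (hN y ⟨hyD, hyγ⟩ b hbD a haD b hbD))
          have : v ≤ σ - u := by linarith
          gcongr
        · have h1 := hres' N₀ hd0
          rw [mem_ball_iff_norm, not_lt] at hyγ
          have h2 : ‖b - a‖^2 ≤ 16/3 * rstar * ‖b - xs‖ := by
            have h3 : rstar/3 ≤ ‖b - xs‖ := by linarith
            have h4 : ‖b - a‖^2 ≤ (‖b - xs‖ + rstar)^2 := by
              gcongr; linarith
            nlinarith [mul_nonneg (sub_nonneg.2 h3)
              (show 0 ≤ 3*rstar - ‖b - xs‖ by linarith)]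
          have h3 := gnk_case (σ := σ) (v := v) (u := u) (d := ‖b - a‖) hN_pos hKpos hN₀_pos
            (norm_nonneg (b - xs)) hrs_pos hv (by rw [hu]; nlinarith [mul_pos hL₀_pos hrs_pos, mul_pos hM₀_pos hrs_pos]) hsc h2
          calc _ ≤ v * ((K * ‖b - xs‖ + N₀ * ‖b - a‖^2) * ‖b - xs‖) := by gcongr
            _ = (v * (K * ‖b - xs‖ + N₀ * ‖b - a‖^2)) * ‖b - xs‖ := by ring
            _ ≤ ((σ - u) * (K * ‖b - xs‖ + N * ‖b - a‖^2)) * ‖b - xs‖ := by gcongr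
            _ = _ := by ring
      have hlast : (σ - u) * (v * ‖x (k+2) - xs‖)
          ≤ (σ - u) * ((K * ‖b - xs‖ + N * ‖b - a‖^2) * ‖b - xs‖) := by
        calc _ = v * ((σ - u) * ‖x (k+2) - xs‖) := by ring
          _ ≤ v * ‖A k (b - xs) - (F b + G b)‖ := by gcongr
          _ ≤ _ := hfin
      have hlast2 := le_of_mul_le_mul_left hlast hc
      have : v⁻¹ * K * ‖b - xs‖^2 + v⁻¹ * N * ‖b - a‖^2 * ‖b - xs‖
          = v⁻¹ * ((K * ‖b - xs‖ + N * ‖b - a‖^2) * ‖b - xs‖) := by ring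
      rw [this]
      rw [inv_mul_eq_div, le_div_iff₀ hvpos]
      linarith
    have hin : ∀ k, ‖x k - xs‖ < rstar ∧ ‖x (k+1) - xs‖ < rstar := by
      intro k
      induction k with
      | zero => exact ⟨mem_ball_iff_norm.1 hinit_m1, mem_ball_iff_norm.1 hinit₀⟩
      | succ k ih =>
        refine ⟨ih.2, ?_⟩
        have h := hstep k ih.1 ih.2
        have hd : ‖x (k+1) - x k‖ ≤ 2 * rstar := by
          have : ‖x (k+1) - x k‖ ≤ ‖x (k+1) - xs‖ + ‖x k - xs‖ := by
            rw [← sub_sub_sub_cancel_right (x (k+1)) (x k) xs]; exact norm_sub_le _ _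
          linarith [ih.1, ih.2]
        have he := ih.2.le
        have : v⁻¹ * K * ‖x (k+1) - xs‖^2 + v⁻¹ * N * ‖x (k+1) - x k‖^2 * ‖x (k+1) - xs‖
            ≤ ‖x (k+1) - xs‖ := by
          calc _ = v⁻¹ * (K * ‖x (k+1) - xs‖ + N * ‖x (k+1) - x k‖^2) * ‖x (k+1) - xs‖ := by ring
            _ ≤ v⁻¹ * (K * rstar + N * (2*rstar)^2) * ‖x (k+1) - xs‖ := by gcongr
            _ = v⁻¹ * v * ‖x (k+1) - xs‖ := by rw [hv]; ring
            _ = _ := by rw [inv_mul_cancel₀ hvpos.ne', one_mul]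
        exact lt_of_le_of_lt (h.trans this) ih.2
    intro k
    exact hstep k (hin k).1 (hin k).2
  refine ⟨hC1, hC2, hmain, ?_⟩
  intro C₅ hC₅ N' hyp k hk
  obtain ⟨h1, h2⟩ := hyp k hk
  refine (hmain k).trans ?_
  have hd : ‖x (k+1) - x k‖ ≤ 2 * ‖x k - xs‖ := by
    have : ‖x (k+1) - x k‖ ≤ ‖x (k+1) - xs‖ + ‖x k - xs‖ := by
      rw [← sub_sub_sub_cancel_right (x (k+1)) (x k) xs]; exact norm_sub_le _ _
    linarith
  have hd2 : ‖x (k+1) - x k‖^2 ≤ 4 * (‖x (k+1) - xs‖ / C₅) := by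
    have h3 : ‖x k - xs‖^2 ≤ ‖x (k+1) - xs‖ / C₅ := by
      rw [le_div_iff₀ hC₅]; linarith
    calc _ ≤ (2 * ‖x k - xs‖)^2 := by gcongr
      _ = 4 * ‖x k - xs‖^2 := by ring
      _ ≤ _ := by gcongr
  have : v⁻¹ * N * ‖x (k+1) - x k‖^2 * ‖x (k+1) - xs‖
      ≤ v⁻¹ * N * (4 * (‖x (k+1) - xs‖ / C₅)) * ‖x (k+1) - xs‖ := by gcongr
  calc _ ≤ v⁻¹ * K * ‖x (k+1) - xs‖^2
      + v⁻¹ * N * (4 * (‖x (k+1) - xs‖ / C₅)) * ‖x (k+1) - xs‖ := by linarith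
    _ = _ := by ring
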